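/- Let σ₁, σ₂ ≥ 0. There is a constant C = C(σ₁, σ₂) such that for every m : ℝ × ℝ → ℂ supported in [1/4, 4] × [1/4, 4] with ‖m‖_{W^{(σ₁,σ₂),2}(ℝ×ℝ)} < ∞, the function ψ(λ₁,λ₂) := m(λ₁², λ₂²) satisfies ‖ψ‖_{W^{(σ₁,σ₂),2}(ℝ×ℝ)} ≤ C · ‖m‖_{W^{(σ₁,σ₂),2}(ℝ×ℝ)}. -/

import Mathlib

open MeasureTheory
open scoped ENNReal

/-- The Fourier transform on `ℝ × ℝ` with convention `𝓕f(ξ) = ∫ f(x) e^{-2πi x·ξ} dx`. -/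
noncomputable def fourier2 (f : ℝ × ℝ → ℂ) (ξ : ℝ × ℝ) : ℂ :=
  ∫ x : ℝ × ℝ, Complex.exp (((-2 * Real.pi * (x.1 * ξ.1 + x.2 * ξ.2) : ℝ) : ℂ) * Complex.I) * f x

/-- The product Sobolev norm `‖f‖_{W^{(σ₁,σ₂),2}(ℝ×ℝ)}`. -/
noncomputable def prodSobolevNorm (σ₁ σ₂ : ℝ) (f : ℝ × ℝ → ℂ) : ℝ≥0∞ :=
  eLpNorm (fun ξ : ℝ × ℝ =>
    (((1 + |ξ.1| ^ 2) ^ (σ₁ / 2) * (1 + |ξ.2| ^ 2) ^ (σ₂ / 2) : ℝ) : ℂ) * fourier2 f ξ)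
    2 volume

open Set Filter Topology
open scoped FourierTransform SchwartzMap ContDiff

/-- A smooth complex-valued function with compact support in `(0, ∞)`. -/
structure IsPosBump (A : ℝ → ℂ) : Prop where
  contDiff : ContDiff ℝ ∞ A
  hasCompactSupport : HasCompactSupport A
  tsupport_subset : tsupport A ⊆ Ioi 0

lemma contDiff_of_contDiffAt_tsupport {f : ℝ → ℂ} (hf : ∀ x ∈ tsupport f, ContDiffAt ℝ ∞ f x) :
    ContDiff ℝ ∞ f := by
  rw [contDiff_iff_contDiffAt]
  intro x
  by_cases hx : x ∈ tsupport f
  · exact hf x hx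
  · exact contDiffAt_const.congr_of_eventuallyEq (notMem_tsupport_iff_eventuallyEq.1 hx)

namespace IsPosBump

variable {A : ℝ → ℂ}

lemma mul (hA : IsPosBump A) {u : ℝ → ℂ} (hu : ∀ x, 0 < x → ContDiffAt ℝ ∞ u x) :
    IsPosBump (fun x => A x * u x) := by
  have hsub : tsupport (fun x => A x * u x) ⊆ tsupport A := tsupport_mul_subset_left
  refine ⟨contDiff_of_contDiffAt_tsupport fun x hx => ?_, hA.hasCompactSupport.mul_right,
    hsub.trans hA.tsupport_subset⟩
  exact hA.contDiff.contDiffAt.mul (hu x (hA.tsupport_subset (hsub hx)))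

lemma derivative (hA : IsPosBump A) : IsPosBump (deriv A) :=
  ⟨hA.contDiff.deriv', hA.hasCompactSupport.deriv,
    tsupport_deriv_subset.trans hA.tsupport_subset⟩

lemma eq_zero (hA : IsPosBump A) {x : ℝ} (hx : x ≤ 0) : A x = 0 := by
  by_contra h
  exact absurd (hA.tsupport_subset (subset_tsupport _ h)) (not_lt.2 hx)

end IsPosBump

lemma contDiffAt_ofReal_sqrt {x : ℝ} (hx : 0 < x) :
    ContDiffAt ℝ ∞ (fun x : ℝ => ((√x : ℝ) : ℂ)) x :=
  Complex.ofRealCLM.contDiff.contDiffAt.comp x (Real.contDiffAt_sqrt hx.ne')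

/-- The modulation of `A` by the character of frequency `ξ` in the variable `√x`. -/
noncomputable def sqrtMod (A : ℝ → ℂ) (ξ x : ℝ) : ℂ :=
  A x * Complex.exp (((-2 * Real.pi * (√x * ξ) : ℝ) : ℂ) * Complex.I)

lemma IsPosBump.modulate {A : ℝ → ℂ} (hA : IsPosBump A) (ξ : ℝ) : IsPosBump (sqrtMod A ξ) := by
  refine hA.mul fun x hx => ?_
  have h := contDiffAt_ofReal_sqrt hx
  have h2 : ContDiffAt ℝ ∞ (fun x : ℝ =>
      Complex.exp (((-2 * Real.pi * ξ : ℝ) : ℂ) * ((√x : ℝ) : ℂ) * Complex.I)) x :=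
    ((contDiffAt_const.mul h).mul contDiffAt_const).cexp
  refine h2.congr_of_eventuallyEq (Eventually.of_forall fun y => ?_)
  simp only
  congr 2
  push_cast
  ring

/-- The frequency-side kernel of `f ↦ 𝓕 (λ ↦ 2 λ A(λ²) f(λ²))`. -/
noncomputable def sqrtKernel (A : ℝ → ℂ) (ξ η : ℝ) : ℂ :=
  ∫ x : ℝ, Complex.exp (((2 * Real.pi * (x * η) : ℝ) : ℂ) * Complex.I) * sqrtMod A ξ x

/-- `sqrtMod A ξ` as a Schwartz function. -/
noncomputable def IsPosBump.schwartz {A : ℝ → ℂ} (hA : IsPosBump A) (ξ : ℝ) : 𝓢(ℝ, ℂ) :=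
  (hA.modulate ξ).hasCompactSupport.toSchwartzMap (hA.modulate ξ).contDiff

lemma IsPosBump.schwartz_apply {A : ℝ → ℂ} (hA : IsPosBump A) (ξ x : ℝ) :
    hA.schwartz ξ x = sqrtMod A ξ x := rfl

lemma fourierInv_real_apply (f : ℝ → ℂ) (η : ℝ) :
    𝓕⁻ f η = ∫ x : ℝ, Complex.exp (((2 * Real.pi * (x * η) : ℝ) : ℂ) * Complex.I) * f x := by
  rw [Real.fourierInv_eq']
  simp [mul_comm]

lemma fourier_real_apply (f : ℝ → ℂ) (η : ℝ) :
    𝓕 f η = ∫ x : ℝ, Complex.exp (((-2 * Real.pi * (x * η) : ℝ) : ℂ) * Complex.I) * f x := by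
  rw [Real.fourier_eq']
  simp [mul_comm]

lemma IsPosBump.sqrtKernel_eq {A : ℝ → ℂ} (hA : IsPosBump A) (ξ η : ℝ) :
    sqrtKernel A ξ η = (𝓕⁻ (hA.schwartz ξ)) η := by
  rw [SchwartzMap.fourierInv_coe, fourierInv_real_apply]
  rfl

lemma IsPosBump.memLp_sqrtKernel {A : ℝ → ℂ} (hA : IsPosBump A) (ξ : ℝ) (p : ℝ≥0∞) :
    MemLp (sqrtKernel A ξ) p := by
  have : sqrtKernel A ξ = 𝓕⁻ (hA.schwartz ξ) := funext (hA.sqrtKernel_eq ξ)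
  rw [this]
  exact (𝓕⁻ (hA.schwartz ξ)).memLp p

/-- Fourier inversion for the kernel. -/
lemma IsPosBump.integral_sqrtKernel {A : ℝ → ℂ} (hA : IsPosBump A) (ξ x : ℝ) :
    ∫ η : ℝ, Complex.exp (((-2 * Real.pi * (η * x) : ℝ) : ℂ) * Complex.I) * sqrtKernel A ξ η =
      sqrtMod A ξ x := by
  have h : (𝓕 (𝓕⁻ (hA.schwartz ξ))) x = hA.schwartz ξ x := by
    rw [FourierTransform.fourier_fourierInv_eq]
  rw [SchwartzMap.fourier_coe, fourier_real_apply] at h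
  simp_rw [hA.sqrtKernel_eq]
  exact h

lemma IsPosBump.measurable_uncurry_sqrtKernel {A : ℝ → ℂ} (hA : IsPosBump A) :
    StronglyMeasurable (Function.uncurry (sqrtKernel A)) := by
  have hm : Measurable A := hA.contDiff.continuous.measurable
  have : StronglyMeasurable (Function.uncurry fun (p : ℝ × ℝ) (x : ℝ) =>
      Complex.exp (((2 * Real.pi * (x * p.2) : ℝ) : ℂ) * Complex.I) * sqrtMod A p.1 x) := by
    apply Measurable.stronglyMeasurable
    unfold sqrtMod Function.uncurry
    fun_prop
  exact this.integral_prod_right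

lemma IsPosBump.integrable_kernel_integrand {A : ℝ → ℂ} (hA : IsPosBump A) (ξ η : ℝ) :
    Integrable fun x : ℝ =>
      Complex.exp (((2 * Real.pi * (x * η) : ℝ) : ℂ) * Complex.I) * sqrtMod A ξ x := by
  apply Continuous.integrable_of_hasCompactSupport
  · have := (hA.modulate ξ).contDiff.continuous
    fun_prop
  · exact (hA.modulate ξ).hasCompactSupport.mul_left

/-- Integration by parts: multiplication by the output frequency. -/
lemma IsPosBump.mul_sqrtKernel {A : ℝ → ℂ} (hA : IsPosBump A) :
    ∃ A₁ A₂ : ℝ → ℂ, IsPosBump A₁ ∧ IsPosBump A₂ ∧ ∀ ξ η : ℝ,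
      (ξ : ℂ) * sqrtKernel A ξ η = sqrtKernel A₁ ξ η + η * sqrtKernel A₂ ξ η := by
  set D : ℝ → ℂ := fun x => A x * ((2 * √x : ℝ) : ℂ) with hD
  have hDb : IsPosBump D := hA.mul fun x hx => by
    simpa using contDiffAt_const.mul (contDiffAt_ofReal_sqrt hx)
  have hD' : IsPosBump (fun x => deriv D x * (1 / (2 * Real.pi * Complex.I))) :=
    hDb.derivative.mul fun x hx => contDiffAt_const
  refine ⟨_, D, hD', hDb, fun ξ η => ?_⟩
  set e : ℝ → ℂ := fun x => Complex.exp (((2 * Real.pi * (x * η) : ℝ) : ℂ) * Complex.I) *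
    Complex.exp (((-2 * Real.pi * (√x * ξ) : ℝ) : ℂ) * Complex.I) with he
  have hder : ∀ x : ℝ, HasDerivAt (fun x => D x * e x)
      (deriv D x * e x + 2 * Real.pi * Complex.I * (η * (D x * e x) - ξ * (A x * e x))) x := by
    intro x
    rcases le_or_gt x 0 with hx | hx
    · have h0 : D =ᶠ[𝓝 x] 0 := notMem_tsupport_iff_eventuallyEq.1
        fun h => absurd (hDb.tsupport_subset h) (not_lt.2 hx)
      have h1 : (fun x => D x * e x) =ᶠ[𝓝 x] fun _ => 0 := by
        filter_upwards [h0] with y hy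
        simp [hy]
      rw [hDb.derivative.eq_zero hx, hDb.eq_zero hx, hA.eq_zero hx]
      simpa using (hasDerivAt_const x (0 : ℂ)).congr_of_eventuallyEq h1
    · have hs : HasDerivAt (fun x : ℝ => ((√x : ℝ) : ℂ)) ((1 / (2 * √x) : ℝ) : ℂ) x :=
        (Real.hasDerivAt_sqrt hx.ne').ofReal_comp
      have h1 : HasDerivAt
          (fun x : ℝ => Complex.exp (((2 * Real.pi * (x * η) : ℝ) : ℂ) * Complex.I))
          (Complex.exp (((2 * Real.pi * (x * η) : ℝ) : ℂ) * Complex.I) *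
            (((2 * Real.pi * (1 * η) : ℝ) : ℂ) * Complex.I)) x :=
        ((((hasDerivAt_id x).mul_const η).const_mul (2 * Real.pi)).ofReal_comp.mul_const _).cexp
      have h2 : HasDerivAt
          (fun x : ℝ => Complex.exp (((-2 * Real.pi * (√x * ξ) : ℝ) : ℂ) * Complex.I))
          (Complex.exp (((-2 * Real.pi * (√x * ξ) : ℝ) : ℂ) * Complex.I) *
            (((-2 * Real.pi * (1 / (2 * √x) * ξ) : ℝ) : ℂ) * Complex.I)) x :=
        ((((Real.hasDerivAt_sqrt hx.ne').mul_const ξ).const_mul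
          (-2 * Real.pi)).ofReal_comp.mul_const _).cexp
      have hDd : HasDerivAt D (deriv D x) x :=
        (hDb.contDiff.differentiable (by simp) x).hasDerivAt
      refine (hDd.mul (h1.mul h2)).congr_deriv ?_
      have hsq : ((√x : ℝ) : ℂ) ≠ 0 := by
        exact_mod_cast (Real.sqrt_pos.2 hx).ne'
      simp only [Pi.mul_apply, he]
      generalize deriv D x = d
      simp only [hD]
      push_cast
      field_simp
      ring
  have key : ∀ B : ℝ → ℂ, sqrtKernel B ξ η = ∫ x, B x * e x := by
    intro B
    unfold sqrtKernel sqrtMod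
    congr 1
    ext x
    simp only [he]
    ring
  have ikey : ∀ B : ℝ → ℂ, IsPosBump B → Integrable (fun x => B x * e x) := by
    intro B hB
    refine (hB.integrable_kernel_integrand ξ η).congr (Eventually.of_forall fun x => ?_)
    simp only [he, sqrtMod]
    ring
  have i1 := ikey _ hDb.derivative
  have i2 := ikey _ hDb
  have i3 := ikey _ hA
  have i4 : Integrable fun x =>
      2 * Real.pi * Complex.I * (η * (D x * e x) - ξ * (A x * e x)) :=
    ((i2.const_mul _).sub (i3.const_mul _)).const_mul _
  have hz := integral_eq_zero_of_hasDerivAt_of_integrable hder (i1.add i4) i2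
  rw [integral_add i1 i4,
    integral_const_mul, integral_sub (i2.const_mul _) (i3.const_mul _), integral_const_mul,
    integral_const_mul] at hz
  have hk : sqrtKernel (fun x => deriv D x * (1 / (2 * Real.pi * Complex.I))) ξ η =
      (1 / (2 * Real.pi * Complex.I)) * ∫ x, deriv D x * e x := by
    rw [key, ← integral_const_mul]
    congr 1
    ext x
    ring
  rw [hk, key, key]
  have hpi : (Real.pi : ℂ) ≠ 0 := by exact_mod_cast Real.pi_ne_zero
  have hI := Complex.I_ne_zero
  field_simp
  linear_combination -hz

lemma eLpNorm_two_sq {α : Type*} [MeasurableSpace α] (μ : Measure α) (f : α → ℂ) :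
    eLpNorm f 2 μ ^ 2 = ∫⁻ x, ‖f x‖ₑ ^ 2 ∂μ := by
  have h := eLpNorm_nnreal_pow_eq_lintegral (μ := μ) (f := f) (p := 2) (by norm_num)
  simpa using h

lemma enorm_integral_mul_le {α : Type*} [MeasurableSpace α] {μ : Measure α} {f g : α → ℂ}
    (hf : AEStronglyMeasurable f μ) (hg : AEStronglyMeasurable g μ) :
    ‖∫ x, f x * g x ∂μ‖ₑ ≤ eLpNorm f 2 μ * eLpNorm g 2 μ :=
  calc ‖∫ x, f x * g x ∂μ‖ₑ ≤ ∫⁻ x, ‖f x * g x‖ₑ ∂μ := enorm_integral_le_lintegral_enorm _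
    _ = eLpNorm (f • g) 1 μ := eLpNorm_one_eq_lintegral_enorm.symm
    _ ≤ _ := eLpNorm_smul_le_mul_eLpNorm hg hf

lemma IsPosBump.exists_eq_zero {A : ℝ → ℂ} (hA : IsPosBump A) :
    ∃ a b : ℝ, 0 < a ∧ ∀ x, x ∉ Icc a b → A x = 0 := by
  rcases (tsupport A).eq_empty_or_nonempty with h | h
  · refine ⟨1, 1, one_pos, fun x _ => image_eq_zero_of_notMem_tsupport (by simp [h])⟩
  · obtain ⟨a, ha⟩ := hA.hasCompactSupport.isCompact.exists_isLeast h
    obtain ⟨b, hb⟩ := hA.hasCompactSupport.isCompact.exists_isGreatest h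
    exact ⟨a, b, hA.tsupport_subset ha.1, fun x hx => image_eq_zero_of_notMem_tsupport
      fun hx' => hx ⟨ha.2 hx', hb.2 hx'⟩⟩

lemma isPosBump_of_eq_zero {f u : ℝ → ℂ} {a b : ℝ} (ha : 0 < a) (hf : ∀ x, x ∉ Icc a b → f x = 0)
    (hfu : ∀ x, 0 < x → f x = u x) (hu : ∀ x, 0 < x → ContDiffAt ℝ ∞ u x) : IsPosBump f := by
  have hsub : tsupport f ⊆ Icc a b := closure_minimal
    (fun x hx => by_contra fun h => hx (hf x h)) isClosed_Icc
  have hpos : tsupport f ⊆ Ioi 0 := fun x hx => ha.trans_le (hsub hx).1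
  refine ⟨contDiff_of_contDiffAt_tsupport fun x hx => ?_, HasCompactSupport.intro isCompact_Icc hf,
    hpos⟩
  refine (hu x (hpos hx)).congr_of_eventuallyEq ?_
  filter_upwards [Ioi_mem_nhds (hpos hx)] with y hy using hfu y hy

/-- Pulling back a bump function by the square map. -/
lemma IsPosBump.comp_sq {A : ℝ → ℂ} (hA : IsPosBump A) {G : ℝ → ℂ} (hG : ContDiff ℝ ∞ G) :
    IsPosBump (fun t => if 0 < t then ((2 * t : ℝ) : ℂ) * (A (t ^ 2) * G (t ^ 2)) else 0) := by
  obtain ⟨a, b, ha, hab⟩ := hA.exists_eq_zero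
  refine isPosBump_of_eq_zero (a := √a) (b := √b)
    (u := fun t => ((2 * t : ℝ) : ℂ) * (A (t ^ 2) * G (t ^ 2))) (Real.sqrt_pos.2 ha) ?_
    (fun x hx => if_pos hx) ?_
  · intro t ht
    by_cases h : 0 < t
    · rw [if_pos h, hab (t ^ 2) fun h' => ht ⟨Real.sqrt_le_iff.2 ⟨h.le, h'.1⟩,
        Real.le_sqrt_of_sq_le h'.2⟩]
      simp
    · rw [if_neg h]
  · intro x _
    have h1 : ContDiff ℝ ∞ (fun t : ℝ => ((2 * t : ℝ) : ℂ)) :=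
      Complex.ofRealCLM.contDiff.comp (contDiff_const.mul contDiff_id)
    have h2 : ContDiff ℝ ∞ (fun t : ℝ => t ^ 2) := contDiff_id.pow 2
    exact (h1.mul ((hA.contDiff.comp h2).mul (hG.comp h2))).contDiffAt

lemma image_sq_Ioi : (fun t : ℝ => t ^ 2) '' Ioi 0 = Ioi 0 := by
  ext x
  constructor
  · rintro ⟨t, ht, rfl⟩
    exact pow_pos (mem_Ioi.1 ht) 2
  · intro hx
    exact ⟨√x, Real.sqrt_pos.2 hx, Real.sq_sqrt (le_of_lt hx)⟩

lemma injOn_sq_Ioi : InjOn (fun t : ℝ => t ^ 2) (Ioi 0) := fun _ hx _ hy h =>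
  (pow_left_inj₀ (le_of_lt hx) (le_of_lt hy) two_ne_zero).1 h

lemma hasDerivWithinAt_sq (s : Set ℝ) (x : ℝ) :
    HasDerivWithinAt (fun t : ℝ => t ^ 2) (2 * x) s x := by
  simpa using (hasDerivAt_pow 2 x).hasDerivWithinAt

lemma setIntegral_Ioi_comp_sq (f : ℝ → ℂ) :
    ∫ x in Ioi (0 : ℝ), f x = ∫ t in Ioi (0 : ℝ), ((2 * t : ℝ) : ℂ) * f (t ^ 2) := by
  have h := integral_image_eq_integral_abs_deriv_smul measurableSet_Ioi
    (fun x _ => hasDerivWithinAt_sq (Ioi 0) x) injOn_sq_Ioi f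
  rw [image_sq_Ioi] at h
  rw [h]
  refine setIntegral_congr_fun measurableSet_Ioi fun t ht => ?_
  simp only [Complex.real_smul]
  rw [abs_of_pos (by have := mem_Ioi.1 ht; positivity)]

lemma setLIntegral_Ioi_comp_sq (f : ℝ → ℝ≥0∞) :
    ∫⁻ x in Ioi (0 : ℝ), f x = ∫⁻ t in Ioi (0 : ℝ), ENNReal.ofReal (2 * t) * f (t ^ 2) := by
  have h := lintegral_image_eq_lintegral_abs_deriv_mul measurableSet_Ioi
    (fun x _ => hasDerivWithinAt_sq (Ioi 0) x) injOn_sq_Ioi f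
  rw [image_sq_Ioi] at h
  rw [h]
  refine setLIntegral_congr_fun measurableSet_Ioi fun t ht => ?_
  rw [abs_of_pos (by have := mem_Ioi.1 ht; positivity)]

/-- The integral operator with kernel `sqrtKernel A`. -/
noncomputable def sqrtOp (A : ℝ → ℂ) (g : ℝ → ℂ) (ξ : ℝ) : ℂ := ∫ η, sqrtKernel A ξ η * g η

lemma IsPosBump.measurable_sqrtOp {A : ℝ → ℂ} (hA : IsPosBump A) {g : ℝ → ℂ} (hg : Measurable g) :
    Measurable (sqrtOp A g) := by
  have : StronglyMeasurable (Function.uncurry fun ξ η => sqrtKernel A ξ η * g η) :=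
    hA.measurable_uncurry_sqrtKernel.mul (hg.comp measurable_snd).stronglyMeasurable
  exact this.integral_prod_right.measurable

lemma SchwartzMap.eLpNorm_fourier (f : 𝓢(ℝ, ℂ)) : eLpNorm (𝓕 f : 𝓢(ℝ, ℂ)) 2 = eLpNorm f 2 := by
  have h := SchwartzMap.norm_fourier_toL2_eq f
  rw [SchwartzMap.norm_toLp, SchwartzMap.norm_toLp] at h
  have h1 : eLpNorm (𝓕 f : 𝓢(ℝ, ℂ)) 2 ≠ ⊤ := by
    have := (𝓕 f : 𝓢(ℝ, ℂ)).memLp 2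
    exact this.2.ne
  have h2 : eLpNorm f 2 ≠ ⊤ := by
    have := f.memLp 2
    exact this.2.ne
  exact (ENNReal.toReal_eq_toReal_iff' h1 h2).1 h

lemma SchwartzMap.eLpNorm_fourierInv (f : 𝓢(ℝ, ℂ)) : eLpNorm (𝓕⁻ f : 𝓢(ℝ, ℂ)) 2 = eLpNorm f 2 := by
  have h := SchwartzMap.eLpNorm_fourier (𝓕⁻ f)
  rw [FourierTransform.fourier_fourierInv_eq] at h
  exact h.symm

lemma IsPosBump.lintegral_sqrtOp_schwartz_le {A : ℝ → ℂ} (hA : IsPosBump A) :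
    ∃ C : ℝ≥0∞, C ≠ ⊤ ∧ ∀ g : 𝓢(ℝ, ℂ), eLpNorm (sqrtOp A g) 2 ≤ C * eLpNorm g 2 := by
  obtain ⟨M, hM⟩ : ∃ M : ℝ, ∀ x, 2 * √x * ‖A x‖ ^ 2 ≤ M := by
    have hB := hA.mul (u := fun x => ((√x : ℝ) : ℂ)) fun x hx => contDiffAt_ofReal_sqrt hx
    obtain ⟨M₁, h₁⟩ := hB.hasCompactSupport.exists_bound_of_continuous hB.contDiff.continuous
    obtain ⟨M₂, h₂⟩ := hA.hasCompactSupport.exists_bound_of_continuous hA.contDiff.continuous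
    refine ⟨2 * (M₁ * M₂), fun x => ?_⟩
    have h3 := h₁ x
    rw [norm_mul, Complex.norm_real, Real.norm_of_nonneg (Real.sqrt_nonneg x)] at h3
    calc 2 * √x * ‖A x‖ ^ 2 = 2 * ((‖A x‖ * √x) * ‖A x‖) := by ring
      _ ≤ 2 * (M₁ * M₂) := by
        gcongr
        · exact (by positivity : (0:ℝ) ≤ ‖A x‖ * √x).trans h3
        · exact h₂ x
  have hM0 : 0 ≤ M := (by positivity : 0 ≤ 2 * √0 * ‖A 0‖ ^ 2).trans (hM 0)
  refine ⟨ENNReal.ofReal (1 + M), by simp, fun g => ?_⟩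
  set G : 𝓢(ℝ, ℂ) := 𝓕⁻ g with hG
  have hb := hA.comp_sq (G.smooth ⊤)
  set h : 𝓢(ℝ, ℂ) := hb.hasCompactSupport.toSchwartzMap hb.contDiff with hh
  have happ : ∀ t, h t = if 0 < t then ((2 * t : ℝ) : ℂ) * (A (t ^ 2) * G (t ^ 2)) else 0 :=
    fun t => rfl
  have hop : sqrtOp A g = (𝓕 h : 𝓢(ℝ, ℂ)) := by
    ext ξ
    calc sqrtOp A g ξ = ∫ η, (𝓕⁻ (hA.schwartz ξ)) η * g η := by
          unfold sqrtOp
          simp_rw [hA.sqrtKernel_eq]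
      _ = ∫ x, hA.schwartz ξ x * G x := SchwartzMap.integral_fourierInv_mul_eq _ _
      _ = ∫ x in Ioi (0 : ℝ), hA.schwartz ξ x * G x := by
          refine (setIntegral_eq_integral_of_forall_compl_eq_zero fun x hx => ?_).symm
          rw [hA.schwartz_apply, sqrtMod, hA.eq_zero (not_lt.1 hx)]
          simp
      _ = ∫ t in Ioi (0 : ℝ), ((2 * t : ℝ) : ℂ) * (hA.schwartz ξ (t ^ 2) * G (t ^ 2)) :=
          setIntegral_Ioi_comp_sq _
      _ = ∫ t in Ioi (0 : ℝ),
            Complex.exp (((-2 * Real.pi * (t * ξ) : ℝ) : ℂ) * Complex.I) * h t := by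
          refine setIntegral_congr_fun measurableSet_Ioi fun t ht => ?_
          simp only [happ, hA.schwartz_apply, sqrtMod]
          rw [if_pos (mem_Ioi.1 ht), Real.sqrt_sq (le_of_lt ht)]
          ring
      _ = ∫ t, Complex.exp (((-2 * Real.pi * (t * ξ) : ℝ) : ℂ) * Complex.I) * h t := by
          refine setIntegral_eq_integral_of_forall_compl_eq_zero fun t ht => ?_
          rw [happ, if_neg (mt mem_Ioi.2 ht), mul_zero]
      _ = (𝓕 h : 𝓢(ℝ, ℂ)) ξ := by rw [SchwartzMap.fourier_coe, fourier_real_apply]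
  rw [hop, SchwartzMap.eLpNorm_fourier, ← SchwartzMap.eLpNorm_fourierInv g]
  have hsq : eLpNorm h 2 ^ 2 ≤ ENNReal.ofReal M * eLpNorm G 2 ^ 2 := by
    rw [eLpNorm_two_sq, eLpNorm_two_sq, ← lintegral_const_mul' _ _ ENNReal.ofReal_ne_top]
    calc ∫⁻ t, ‖h t‖ₑ ^ 2 = ∫⁻ t in Ioi (0 : ℝ), ‖h t‖ₑ ^ 2 := by
          refine (setLIntegral_eq_of_support_subset fun t ht => ?_).symm
          by_contra h0
          exact ht (by simp only [happ, if_neg (mt mem_Ioi.2 h0)]; simp)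
      _ = ∫⁻ t in Ioi (0 : ℝ), ENNReal.ofReal (2 * t) *
            (ENNReal.ofReal (2 * √(t ^ 2) * ‖A (t ^ 2)‖ ^ 2) * ‖G (t ^ 2)‖ₑ ^ 2) := by
          refine setLIntegral_congr_fun measurableSet_Ioi fun t ht => ?_
          have ht' : 0 < t := ht
          simp only [happ, if_pos ht', Real.sqrt_sq ht'.le]
          have h2t : ‖((2 * t : ℝ) : ℂ)‖ₑ = ENNReal.ofReal (2 * t) := by
            rw [← ofReal_norm, Complex.norm_real, Real.norm_of_nonneg (by positivity)]
          rw [enorm_mul, enorm_mul, h2t, ENNReal.ofReal_mul (by positivity : 0 ≤ 2 * t),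
            ENNReal.ofReal_pow (norm_nonneg _), ofReal_norm]
          ring
      _ = ∫⁻ x in Ioi (0 : ℝ), ENNReal.ofReal (2 * √x * ‖A x‖ ^ 2) * ‖G x‖ₑ ^ 2 :=
          (setLIntegral_Ioi_comp_sq
            (fun x => ENNReal.ofReal (2 * √x * ‖A x‖ ^ 2) * ‖G x‖ₑ ^ 2)).symm
      _ ≤ ∫⁻ x, ENNReal.ofReal (2 * √x * ‖A x‖ ^ 2) * ‖G x‖ₑ ^ 2 := setLIntegral_le_lintegral _ _
      _ ≤ ∫⁻ x, ENNReal.ofReal M * ‖G x‖ₑ ^ 2 := by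
          gcongr with x
          exact hM x
  rw [← ENNReal.pow_le_pow_left_iff two_ne_zero, mul_pow, ← ENNReal.ofReal_pow (by linarith)]
  refine hsq.trans ?_
  gcongr
  nlinarith

lemma exists_schwartz_approx {g : ℝ → ℂ} (hg : MemLp g 2) :
    ∃ s : ℕ → ℝ → ℂ, (∀ n, ∃ S : 𝓢(ℝ, ℂ), ⇑S = s n) ∧ (∀ n, Measurable (s n)) ∧
      (∀ n, MemLp (s n) 2) ∧ ∀ n : ℕ, eLpNorm (g - s n) 2 ≤ ENNReal.ofReal (1 / (n + 1)) := by
  have hex : ∀ n : ℕ, ∃ s : ℝ → ℂ, (∃ S : 𝓢(ℝ, ℂ), ⇑S = s) ∧ Measurable s ∧ MemLp s 2 ∧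
      eLpNorm (g - s) 2 ≤ ENNReal.ofReal (1 / (n + 1)) := by
    intro n
    obtain ⟨s, h1, h2, h3⟩ := MemLp.exist_eLpNorm_sub_le (p := 2) (by simp) (by norm_num) hg
      (ε := 1 / (n + 1)) (by positivity)
    exact ⟨s, ⟨h1.toSchwartzMap h2, rfl⟩, h2.continuous.measurable,
      h2.continuous.memLp_of_hasCompactSupport h1, h3⟩
  choose s hs using hex
  exact ⟨s, fun n => (hs n).1, fun n => (hs n).2.1, fun n => (hs n).2.2.1, fun n => (hs n).2.2.2⟩

/-- The operator `sqrtOp A` is bounded on `L²`. -/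
lemma IsPosBump.lintegral_sqrtOp_le {A : ℝ → ℂ} (hA : IsPosBump A) :
    ∃ C : ℝ≥0∞, C ≠ ⊤ ∧ ∀ g : ℝ → ℂ, Measurable g →
      ∫⁻ ξ, ‖sqrtOp A g ξ‖ₑ ^ 2 ≤ C * ∫⁻ η, ‖g η‖ₑ ^ 2 := by
  obtain ⟨C, hC, hS⟩ := hA.lintegral_sqrtOp_schwartz_le
  refine ⟨(C + 1) ^ 2, by finiteness, fun g hg => ?_⟩
  rw [← eLpNorm_two_sq, ← eLpNorm_two_sq, ← mul_pow]
  gcongr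
  by_cases hfin : eLpNorm g 2 = ⊤
  · rw [hfin, ENNReal.mul_top (by simp)]
    exact le_top
  have hgL : MemLp g 2 := ⟨hg.aestronglyMeasurable, lt_top_iff_ne_top.2 hfin⟩
  obtain ⟨s, hsS, hsmeas, hsm, hs⟩ := exists_schwartz_approx hgL
  replace hS : ∀ n, eLpNorm (sqrtOp A (s n)) 2 ≤ C * eLpNorm (s n) 2 := fun n => by
    obtain ⟨S, hn⟩ := hsS n
    rw [← hn]
    exact hS S
  have hlim0 : Tendsto (fun n : ℕ => ENNReal.ofReal (1 / (n + 1))) atTop (𝓝 0) := by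
    have := ENNReal.tendsto_ofReal (tendsto_one_div_add_atTop_nhds_zero_nat (𝕜 := ℝ))
    simpa using this
  have hsL : Tendsto (fun n => eLpNorm (g - s n) 2) atTop (𝓝 0) :=
    tendsto_of_tendsto_of_tendsto_of_le_of_le tendsto_const_nhds hlim0 (fun _ => zero_le) hs
  have hptw : ∀ ξ, Tendsto (fun n => sqrtOp A (s n) ξ) atTop (𝓝 (sqrtOp A g ξ)) := by
    intro ξ
    have hK := hA.memLp_sqrtKernel ξ 2
    rw [tendsto_iff_edist_tendsto_0]
    have hbd : ∀ n, edist (sqrtOp A (s n) ξ) (sqrtOp A g ξ) ≤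
        eLpNorm (sqrtKernel A ξ) 2 * eLpNorm (g - s n) 2 := by
      intro n
      have hi1 : Integrable (fun η => sqrtKernel A ξ η * g η) := hK.integrable_mul hgL
      have hi2 : Integrable (fun η => sqrtKernel A ξ η * s n η) := hK.integrable_mul (hsm n)
      rw [edist_comm, edist_eq_enorm_sub]
      unfold sqrtOp
      rw [← integral_sub hi1 hi2]
      simp_rw [← mul_sub]
      exact enorm_integral_mul_le hK.1 (hgL.1.sub (hsm n).1)
    refine tendsto_of_tendsto_of_tendsto_of_le_of_le tendsto_const_nhds ?_ (fun _ => zero_le) hbd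
    simpa using ENNReal.Tendsto.const_mul hsL (Or.inr hK.2.ne)
  have h1 : eLpNorm (sqrtOp A g) 2 ≤ liminf (fun n => eLpNorm (sqrtOp A (s n)) 2) atTop :=
    Lp.eLpNorm_lim_le_liminf_eLpNorm
      (fun n => (hA.measurable_sqrtOp (hsmeas n)).aestronglyMeasurable) _
      (Eventually.of_forall hptw)
  have h2 : ∀ n, eLpNorm (sqrtOp A (s n)) 2 ≤ C * (eLpNorm g 2 + eLpNorm (g - s n) 2) := by
    refine fun n => (hS n).trans ?_
    gcongr
    have h3 : s n = g - (g - s n) := by simp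
    conv_lhs => rw [h3]
    exact eLpNorm_sub_le hgL.1 (hgL.1.sub (hsm n).1) (by norm_num)
  have h4 : Tendsto (fun n => C * (eLpNorm g 2 + eLpNorm (g - s n) 2)) atTop
      (𝓝 (C * (eLpNorm g 2 + 0))) :=
    ENNReal.Tendsto.const_mul (tendsto_const_nhds.add hsL) (Or.inr hC)
  have h5 := h1.trans (liminf_le_liminf (Eventually.of_forall h2))
  rw [h4.liminf_eq, add_zero] at h5
  refine h5.trans ?_
  gcongr
  exact le_self_add

/-- The square of the norm of `L²((1 + ξ²)ˢ dξ)`. -/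
noncomputable def wNormSq (s : ℝ) (g : ℝ → ℂ) : ℝ≥0∞ :=
  ∫⁻ ξ, ENNReal.ofReal ((1 + ξ ^ 2) ^ s) * ‖g ξ‖ₑ ^ 2

lemma one_le_weight (ξ : ℝ) : 1 ≤ 1 + ξ ^ 2 := by nlinarith [sq_nonneg ξ]

lemma weight_pos (ξ : ℝ) : 0 < 1 + ξ ^ 2 := by positivity

lemma wNormSq_zero (g : ℝ → ℂ) : wNormSq 0 g = ∫⁻ ξ, ‖g ξ‖ₑ ^ 2 := by
  simp [wNormSq]

lemma wNormSq_mono {s s' : ℝ} (h : s ≤ s') (g : ℝ → ℂ) : wNormSq s g ≤ wNormSq s' g := by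
  unfold wNormSq
  gcongr with ξ
  exact one_le_weight ξ

lemma memLp_of_wNormSq {s : ℝ} (hs : 0 ≤ s) {g : ℝ → ℂ} (hg : Measurable g)
    (h : wNormSq s g ≠ ⊤) : MemLp g 2 := by
  refine ⟨hg.aestronglyMeasurable, ?_⟩
  have h1 : eLpNorm g 2 ^ 2 ≤ wNormSq s g := by
    rw [eLpNorm_two_sq, ← wNormSq_zero]
    exact wNormSq_mono hs g
  have h2 := h1.trans_lt (lt_top_iff_ne_top.2 h)
  by_contra h3
  rw [not_lt, top_le_iff] at h3
  rw [h3] at h2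
  simp at h2

lemma enorm_add_sq_le (a b : ℂ) : ‖a + b‖ₑ ^ 2 ≤ 2 * (‖a‖ₑ ^ 2 + ‖b‖ₑ ^ 2) := by
  have h := ENNReal.rpow_add_le_mul_rpow_add_rpow ‖a‖ₑ ‖b‖ₑ (one_le_two)
  norm_num at h
  exact (ENNReal.pow_le_pow_left (enorm_add_le a b)).trans h

lemma measurable_weight (s : ℝ) : Measurable fun ξ : ℝ => ENNReal.ofReal ((1 + ξ ^ 2) ^ s) := by
  fun_prop

lemma wNormSq_add_le {s : ℝ} {g₁ g₂ : ℝ → ℂ} (h₁ : Measurable g₁) :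
    wNormSq s (fun ξ => g₁ ξ + g₂ ξ) ≤ 2 * (wNormSq s g₁ + wNormSq s g₂) := by
  unfold wNormSq
  rw [← lintegral_add_left (by have := measurable_weight s; fun_prop),
    ← lintegral_const_mul' _ _ (by simp)]
  refine lintegral_mono fun ξ => ?_
  calc ENNReal.ofReal ((1 + ξ ^ 2) ^ s) * ‖g₁ ξ + g₂ ξ‖ₑ ^ 2
      ≤ ENNReal.ofReal ((1 + ξ ^ 2) ^ s) * (2 * (‖g₁ ξ‖ₑ ^ 2 + ‖g₂ ξ‖ₑ ^ 2)) :=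
        mul_le_mul' le_rfl (enorm_add_sq_le _ _)
    _ = _ := by ring

lemma wNormSq_succ {s : ℝ} {g : ℝ → ℂ} (hg : Measurable g) :
    wNormSq (s + 1) g = wNormSq s g + wNormSq s (fun ξ => ξ * g ξ) := by
  unfold wNormSq
  rw [← lintegral_add_left (by have := measurable_weight s; fun_prop)]
  congr 1
  ext ξ
  have h : ‖(ξ : ℂ)‖ₑ ^ 2 = ENNReal.ofReal (ξ ^ 2) := by
    rw [← ofReal_norm, Complex.norm_real, ← ENNReal.ofReal_pow (norm_nonneg _), Real.norm_eq_abs,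
      sq_abs]
  rw [Real.rpow_add (weight_pos ξ), Real.rpow_one, enorm_mul, mul_pow, h,
    ENNReal.ofReal_mul (by positivity), ENNReal.ofReal_add (by norm_num) (by positivity),
    ENNReal.ofReal_one]
  ring

lemma wNormSq_mul_id_le {s : ℝ} {g : ℝ → ℂ} (hg : Measurable g) :
    wNormSq s (fun η => η * g η) ≤ wNormSq (s + 1) g := by
  rw [wNormSq_succ hg]
  exact le_add_left le_rfl

lemma IsPosBump.integrable_sqrtKernel_mul {A : ℝ → ℂ} (hA : IsPosBump A) {g : ℝ → ℂ}
    (hg : MemLp g 2) (ξ : ℝ) : Integrable fun η => sqrtKernel A ξ η * g η :=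
  (hA.memLp_sqrtKernel ξ 2).integrable_mul hg

lemma IsPosBump.wNormSq_nat_le (N : ℕ) : ∀ {A : ℝ → ℂ}, IsPosBump A →
    ∃ C : ℝ≥0∞, C ≠ ⊤ ∧ ∀ g : ℝ → ℂ, Measurable g → wNormSq N (sqrtOp A g) ≤ C * wNormSq N g := by
  induction N with
  | zero =>
    intro A hA
    simpa [wNormSq_zero] using hA.lintegral_sqrtOp_le
  | succ N ih =>
    intro A hA
    obtain ⟨A₁, A₂, h₁, h₂, hK⟩ := hA.mul_sqrtKernel
    obtain ⟨C, hC, hb⟩ := ih hA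
    obtain ⟨C₁, hC₁, hb₁⟩ := ih h₁
    obtain ⟨C₂, hC₂, hb₂⟩ := ih h₂
    refine ⟨1 + (C + 2 * (C₁ + C₂)), by finiteness, fun g hg => ?_⟩
    push_cast
    by_cases hfin : wNormSq (N + 1) g = ⊤
    · rw [hfin, ENNReal.mul_top (by simp)]
      exact le_top
    have hgid : Measurable fun η : ℝ => (η : ℂ) * g η := by fun_prop
    have hg2 : MemLp g 2 := memLp_of_wNormSq (by positivity) hg hfin
    have hg3 : MemLp (fun η : ℝ => (η : ℂ) * g η) 2 :=
      memLp_of_wNormSq (s := N) (by positivity) hgid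
        ((wNormSq_mul_id_le hg).trans_lt (lt_top_iff_ne_top.2 hfin)).ne
    have hmul : (fun ξ : ℝ => (ξ : ℂ) * sqrtOp A g ξ) =
        fun ξ => sqrtOp A₁ g ξ + sqrtOp A₂ (fun η => η * g η) ξ := by
      ext ξ
      unfold sqrtOp
      rw [← integral_add (h₁.integrable_sqrtKernel_mul hg2 ξ)
        (h₂.integrable_sqrtKernel_mul hg3 ξ), ← integral_const_mul]
      congr 1
      ext η
      linear_combination g η * hK ξ η
    have hle := wNormSq_mono (by linarith : (N : ℝ) ≤ N + 1) g
    have hle' := wNormSq_mul_id_le (s := N) hg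
    rw [wNormSq_succ (hA.measurable_sqrtOp hg), hmul]
    calc wNormSq N (sqrtOp A g) +
          wNormSq N (fun ξ => sqrtOp A₁ g ξ + sqrtOp A₂ (fun η => η * g η) ξ)
        ≤ C * wNormSq N g +
          2 * (C₁ * wNormSq N g + C₂ * wNormSq N (fun η => η * g η)) := by
          gcongr
          · exact hb g hg
          · refine (wNormSq_add_le (h₁.measurable_sqrtOp hg)).trans ?_
            gcongr
            · exact hb₁ g hg
            · exact hb₂ _ hgid
      _ ≤ C * wNormSq (N + 1) g +
          2 * (C₁ * wNormSq (N + 1) g + C₂ * wNormSq (N + 1) g) := by gcongr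
      _ = (C + 2 * (C₁ + C₂)) * wNormSq (N + 1) g := by ring
      _ ≤ (1 + (C + 2 * (C₁ + C₂))) * wNormSq (N + 1) g :=
          mul_le_mul' (le_add_left le_rfl) le_rfl

lemma lintegral_rpow_Ioo {s w : ℝ} (hs : 0 < s) (hw : 0 < w) :
    ∫⁻ t in Ioi (0 : ℝ), ENNReal.ofReal (s * t ^ (s - 1)) * (if t < w then 1 else 0) =
      ENNReal.ofReal (w ^ s) := by
  have hi : IntegrableOn (fun t : ℝ => s * t ^ (s - 1)) (Ioc 0 w) :=
    ((intervalIntegrable_iff_integrableOn_Ioc_of_le hw.le).1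
      (intervalIntegral.intervalIntegrable_rpow' (by linarith))).const_mul s
  have h1 : ∫ t in Ioc 0 w, s * t ^ (s - 1) = w ^ s := by
    rw [← intervalIntegral.integral_of_le hw.le, intervalIntegral.integral_const_mul,
      integral_rpow (Or.inl (by linarith))]
    simp [Real.zero_rpow hs.ne']
    field_simp
  rw [← h1, ofReal_integral_eq_lintegral_ofReal hi, ← setLIntegral_congr Ioo_ae_eq_Ioc,
    ← Ioi_inter_Iio, inter_comm, ← setLIntegral_indicator measurableSet_Iio]
  · refine lintegral_congr fun t => ?_
    simp [indicator_apply]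
  · refine (ae_restrict_mem measurableSet_Ioc).mono fun t ht => ?_
    have := ht.1
    simp only [Pi.zero_apply]
    positivity

lemma lintegral_rpow_Ici {s N w : ℝ} (hs : 0 < s) (hN : s < N) (hw : 0 < w) :
    ∫⁻ t in Ioi (0 : ℝ), ENNReal.ofReal (s * t ^ (s - 1)) *
        (if t < w then 0 else ENNReal.ofReal ((w / t) ^ N)) =
      ENNReal.ofReal (s / (N - s)) * ENNReal.ofReal (w ^ s) := by
  have hi : IntegrableOn (fun t : ℝ => s * w ^ N * t ^ (s - 1 - N)) (Ioi w) :=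
    (integrableOn_Ioi_rpow_of_lt (by linarith) hw).const_mul _
  have h1 : ∫ t in Ioi w, s * w ^ N * t ^ (s - 1 - N) = s / (N - s) * w ^ s := by
    have hNs : N - s ≠ 0 := by linarith
    have hNs' : s - 1 - N + 1 ≠ 0 := by linarith
    rw [integral_const_mul, integral_Ioi_rpow_of_lt (by linarith) hw]
    have : w ^ s = w ^ N * w ^ (s - 1 - N + 1) := by
      rw [← Real.rpow_add hw]
      ring_nf
    rw [this]
    field_simp
    ring
  rw [← ENNReal.ofReal_mul (div_nonneg hs.le (by linarith)), ← h1,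
    ofReal_integral_eq_lintegral_ofReal hi, setLIntegral_congr (Ioi_ae_eq_Ici (a := w)),
    ← inter_eq_left.2 (Ici_subset_Ioi.2 hw), ← setLIntegral_indicator measurableSet_Ici]
  · refine setLIntegral_congr_fun measurableSet_Ioi fun t ht => ?_
    have ht' : 0 < t := ht
    by_cases h : t < w
    · simp [h]
    · simp only [indicator_apply, h, if_false, mem_Ici, not_lt.1 h, if_true]
      rw [← ENNReal.ofReal_mul (by positivity), Real.div_rpow hw.le ht'.le, Real.rpow_sub ht' _ N]
      congr 1
      ring
  · refine (ae_restrict_mem measurableSet_Ioi).mono fun t ht => ?_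
    have := hw.trans ht
    simp only [Pi.zero_apply]
    positivity

/-- Splitting the data at height `t` of the weight. -/
lemma IsPosBump.lintegral_sqrtOp_split_le {A : ℝ → ℂ} (hA : IsPosBump A) (N : ℕ) :
    ∃ C : ℝ≥0∞, C ≠ ⊤ ∧ ∀ g : ℝ → ℂ, Measurable g → MemLp g 2 → ∀ t : ℝ, 0 < t →
      ∫⁻ ξ, (if t < 1 + ξ ^ 2 then 1 else 0) * ‖sqrtOp A g ξ‖ₑ ^ 2 ≤
        C * ∫⁻ η, ((if t < 1 + η ^ 2 then 1 else 0) +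
          (if t < 1 + η ^ 2 then 0 else ENNReal.ofReal (((1 + η ^ 2) / t) ^ (N : ℝ)))) *
            ‖g η‖ₑ ^ 2 := by
  obtain ⟨C₀, hC₀, hb₀⟩ := hA.lintegral_sqrtOp_le
  obtain ⟨C₁, hC₁, hb₁⟩ := hA.wNormSq_nat_le N
  refine ⟨2 * (C₀ + C₁), by finiteness, fun g hg hg2 t ht => ?_⟩
  set S : Set ℝ := {η | t < 1 + η ^ 2} with hS
  have hSm : MeasurableSet S := measurableSet_lt measurable_const (by fun_prop)
  have hhi : Measurable (S.indicator g) := hg.indicator hSm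
  have hlo : Measurable (Sᶜ.indicator g) := hg.indicator hSm.compl
  have hsplit : ∀ ξ, sqrtOp A g ξ = sqrtOp A (S.indicator g) ξ + sqrtOp A (Sᶜ.indicator g) ξ := by
    intro ξ
    unfold sqrtOp
    rw [← integral_add (hA.integrable_sqrtKernel_mul (hg2.indicator hSm) ξ)
      (hA.integrable_sqrtKernel_mul (hg2.indicator hSm.compl) ξ)]
    congr 1
    ext η
    rw [← mul_add, ← Pi.add_apply, indicator_self_add_compl]
  have htN : ENNReal.ofReal ((1 / t) ^ (N : ℝ)) ≠ ⊤ := ENNReal.ofReal_ne_top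
  have hpt : ∀ ξ, (if t < 1 + ξ ^ 2 then (1 : ℝ≥0∞) else 0) * ‖sqrtOp A g ξ‖ₑ ^ 2 ≤
      2 * (‖sqrtOp A (S.indicator g) ξ‖ₑ ^ 2 + ENNReal.ofReal ((1 / t) ^ (N : ℝ)) *
        (ENNReal.ofReal ((1 + ξ ^ 2) ^ (N : ℝ)) * ‖sqrtOp A (Sᶜ.indicator g) ξ‖ₑ ^ 2)) := by
    intro ξ
    split_ifs with h
    · rw [one_mul, hsplit]
      refine (enorm_add_sq_le _ _).trans (mul_le_mul' le_rfl (add_le_add le_rfl ?_))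
      rw [← mul_assoc, ← ENNReal.ofReal_mul (by positivity),
        ← Real.mul_rpow (by positivity) (by positivity)]
      refine le_mul_of_one_le_left' (ENNReal.one_le_ofReal.2 (Real.one_le_rpow ?_ (by positivity)))
      rw [one_div_mul_eq_div, one_le_div ht]
      exact h.le
    · simp
  calc ∫⁻ ξ, (if t < 1 + ξ ^ 2 then (1 : ℝ≥0∞) else 0) * ‖sqrtOp A g ξ‖ₑ ^ 2
      ≤ ∫⁻ ξ, 2 * (‖sqrtOp A (S.indicator g) ξ‖ₑ ^ 2 + ENNReal.ofReal ((1 / t) ^ (N : ℝ)) *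
        (ENNReal.ofReal ((1 + ξ ^ 2) ^ (N : ℝ)) * ‖sqrtOp A (Sᶜ.indicator g) ξ‖ₑ ^ 2)) :=
        lintegral_mono hpt
    _ = 2 * ((∫⁻ ξ, ‖sqrtOp A (S.indicator g) ξ‖ₑ ^ 2) +
          ENNReal.ofReal ((1 / t) ^ (N : ℝ)) * wNormSq N (sqrtOp A (Sᶜ.indicator g))) := by
        have := hA.measurable_sqrtOp hhi
        rw [lintegral_const_mul' _ _ (by simp), lintegral_add_left (by fun_prop),
          lintegral_const_mul' _ _ htN, wNormSq]
    _ ≤ 2 * (C₀ * (∫⁻ η, ‖S.indicator g η‖ₑ ^ 2) +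
          ENNReal.ofReal ((1 / t) ^ (N : ℝ)) * (C₁ * wNormSq N (Sᶜ.indicator g))) := by
        gcongr
        · exact hb₀ _ hhi
        · exact hb₁ _ hlo
    _ ≤ 2 * ((C₀ + C₁) * (∫⁻ η, ‖S.indicator g η‖ₑ ^ 2) +
          ENNReal.ofReal ((1 / t) ^ (N : ℝ)) * ((C₀ + C₁) * wNormSq N (Sᶜ.indicator g))) := by
        gcongr
        · exact le_add_right le_rfl
        · exact le_add_left le_rfl
    _ = 2 * (C₀ + C₁) * ((∫⁻ η, ‖S.indicator g η‖ₑ ^ 2) +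
          ENNReal.ofReal ((1 / t) ^ (N : ℝ)) * wNormSq N (Sᶜ.indicator g)) := by ring
    _ = _ := by
        rw [wNormSq, ← lintegral_const_mul' _ _ htN, ← lintegral_add_left (by fun_prop)]
        congr 2
        ext η
        by_cases h : t < 1 + η ^ 2
        · have h' : η ∈ S := h
          simp [h, h']
        · have h' : η ∉ S := h
          simp only [h, h', if_false, indicator_of_notMem, not_false_eq_true, mem_compl_iff,
            indicator_of_mem, zero_add, enorm_zero]
          rw [← mul_assoc, ← ENNReal.ofReal_mul (by positivity),
            ← Real.mul_rpow (by positivity) (by positivity), one_div_mul_eq_div]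
          simp

/-- `sqrtOp A` is bounded on `L²((1 + ξ²)ˢ dξ)` for every `s ≥ 0`. -/
lemma IsPosBump.wNormSq_sqrtOp_le {A : ℝ → ℂ} (hA : IsPosBump A) {s : ℝ} (hs : 0 ≤ s) :
    ∃ C : ℝ≥0∞, C ≠ ⊤ ∧ ∀ g : ℝ → ℂ, Measurable g → wNormSq s (sqrtOp A g) ≤ C * wNormSq s g := by
  rcases hs.eq_or_lt with rfl | hs'
  · simpa [wNormSq_zero] using hA.lintegral_sqrtOp_le
  obtain ⟨N, hN⟩ := exists_nat_gt s
  obtain ⟨C, hC, hb⟩ := hA.lintegral_sqrtOp_split_le N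
  refine ⟨1 + C * (1 + ENNReal.ofReal (s / (N - s))), by finiteness, fun g hg => ?_⟩
  by_cases hfin : wNormSq s g = ⊤
  · rw [hfin, ENNReal.mul_top (by simp)]
    exact le_top
  have hg2 := memLp_of_wNormSq hs hg hfin
  have hTg := hA.measurable_sqrtOp hg
  set k : ℝ → ℝ≥0∞ := fun t => ENNReal.ofReal (s * t ^ (s - 1)) with hk
  have hkm : Measurable k := by fun_prop
  have hind : Measurable fun p : ℝ × ℝ => if p.2 < 1 + p.1 ^ 2 then (1 : ℝ≥0∞) else 0 :=
    Measurable.ite (measurableSet_lt (by fun_prop) (by fun_prop)) measurable_const measurable_const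
  have hind' : Measurable fun p : ℝ × ℝ => if p.2 < 1 + p.1 ^ 2 then (0 : ℝ≥0∞) else
      ENNReal.ofReal (((1 + p.1 ^ 2) / p.2) ^ (N : ℝ)) :=
    Measurable.ite (measurableSet_lt (by fun_prop) (by fun_prop)) measurable_const (by fun_prop)
  calc wNormSq s (sqrtOp A g)
      = ∫⁻ ξ, ∫⁻ t in Ioi (0 : ℝ), k t * ((if t < 1 + ξ ^ 2 then 1 else 0) *
          ‖sqrtOp A g ξ‖ₑ ^ 2) := by
        unfold wNormSq
        refine lintegral_congr fun ξ => ?_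
        rw [← lintegral_rpow_Ioo hs' (weight_pos ξ), ← lintegral_mul_const'' _ ?_]
        · simp only [hk, mul_assoc]
        · exact (hkm.mul (hind.comp (measurable_const.prodMk measurable_id))).aemeasurable
    _ = ∫⁻ t in Ioi (0 : ℝ), ∫⁻ ξ, k t * ((if t < 1 + ξ ^ 2 then 1 else 0) *
          ‖sqrtOp A g ξ‖ₑ ^ 2) := by
        refine lintegral_lintegral_swap (Measurable.aemeasurable ?_)
        exact (hkm.comp measurable_snd).mul
          (hind.mul (((hTg.comp measurable_fst).enorm).pow_const 2))
    _ ≤ ∫⁻ t in Ioi (0 : ℝ), ∫⁻ η, k t * (C * (((if t < 1 + η ^ 2 then 1 else 0) +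
          (if t < 1 + η ^ 2 then 0 else ENNReal.ofReal (((1 + η ^ 2) / t) ^ (N : ℝ)))) *
            ‖g η‖ₑ ^ 2)) := by
        refine setLIntegral_mono' measurableSet_Ioi fun t ht => ?_
        have hkt : k t ≠ ⊤ := ENNReal.ofReal_ne_top
        rw [lintegral_const_mul' _ _ hkt, lintegral_const_mul' _ _ hkt, lintegral_const_mul' _ _ hC]
        exact mul_le_mul' le_rfl (hb g hg hg2 t ht)
    _ = ∫⁻ η, ∫⁻ t in Ioi (0 : ℝ), k t * (C * (((if t < 1 + η ^ 2 then 1 else 0) +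
          (if t < 1 + η ^ 2 then 0 else ENNReal.ofReal (((1 + η ^ 2) / t) ^ (N : ℝ)))) *
            ‖g η‖ₑ ^ 2)) := by
        refine (lintegral_lintegral_swap (Measurable.aemeasurable ?_)).symm
        exact (hkm.comp measurable_snd).mul ((measurable_const).mul
          ((hind.add hind').mul (((hg.comp measurable_fst).enorm).pow_const 2)))
    _ = ∫⁻ η, C * (1 + ENNReal.ofReal (s / (N - s))) *
          (ENNReal.ofReal ((1 + η ^ 2) ^ s) * ‖g η‖ₑ ^ 2) := by
        refine lintegral_congr fun η => ?_
        have h1 := lintegral_rpow_Ioo hs' (weight_pos η)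
        have h2 := lintegral_rpow_Ici hs' hN (weight_pos η)
        have hm1 : Measurable fun t : ℝ => k t * if t < 1 + η ^ 2 then (1 : ℝ≥0∞) else 0 :=
          hkm.mul (hind.comp (measurable_const.prodMk measurable_id))
        have hm2 : Measurable fun t : ℝ => k t * if t < 1 + η ^ 2 then (0 : ℝ≥0∞) else
            ENNReal.ofReal (((1 + η ^ 2) / t) ^ (N : ℝ)) :=
          hkm.mul (hind'.comp (measurable_const.prodMk measurable_id))
        calc _ = ∫⁻ t in Ioi (0 : ℝ), ((k t * if t < 1 + η ^ 2 then (1 : ℝ≥0∞) else 0) +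
              (k t * if t < 1 + η ^ 2 then (0 : ℝ≥0∞) else
                ENNReal.ofReal (((1 + η ^ 2) / t) ^ (N : ℝ)))) * (C * ‖g η‖ₑ ^ 2) := by
              refine lintegral_congr fun t => ?_
              ring
          _ = _ := by
              rw [lintegral_mul_const' _ _ (by finiteness), lintegral_add_left hm1, h1, h2]
              ring
    _ = C * (1 + ENNReal.ofReal (s / (N - s))) * wNormSq s g :=
        lintegral_const_mul' _ _ (by finiteness)
    _ ≤ _ := mul_le_mul' (le_add_left le_rfl) le_rfl

/-- The square of the norm of `L²((1 + ξ₁²)^s₁ (1 + ξ₂²)^s₂ dξ)`, as an iterated integral. -/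
noncomputable def wNormSq₂ (s₁ s₂ : ℝ) (G : ℝ × ℝ → ℂ) : ℝ≥0∞ :=
  ∫⁻ ξ₁, ENNReal.ofReal ((1 + ξ₁ ^ 2) ^ s₁) * wNormSq s₂ (fun ξ₂ => G (ξ₁, ξ₂))

lemma wNormSq₂_eq_swap (s₁ s₂ : ℝ) {G : ℝ × ℝ → ℂ} (hG : Measurable G) :
    wNormSq₂ s₁ s₂ G =
      ∫⁻ ξ₂, ENNReal.ofReal ((1 + ξ₂ ^ 2) ^ s₂) * wNormSq s₁ (fun ξ₁ => G (ξ₁, ξ₂)) := by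
  unfold wNormSq₂ wNormSq
  simp_rw [← lintegral_const_mul' _ _ ENNReal.ofReal_ne_top]
  rw [lintegral_lintegral_swap]
  · refine lintegral_congr fun ξ₂ => lintegral_congr fun ξ₁ => ?_
    ring
  · have h₁ : Measurable fun p : ℝ × ℝ => ENNReal.ofReal ((1 + p.1 ^ 2) ^ s₁) := by fun_prop
    have h₂ : Measurable fun p : ℝ × ℝ => ENNReal.ofReal ((1 + p.2 ^ 2) ^ s₂) := by fun_prop
    exact (h₁.mul (h₂.mul (hG.enorm.pow_const 2))).aemeasurable

/-- `sqrtOp A` applied in both variables. -/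
noncomputable def sqrtOp₂ (A : ℝ → ℂ) (G : ℝ × ℝ → ℂ) (ξ : ℝ × ℝ) : ℂ :=
  sqrtOp A (fun η₂ => sqrtOp A (fun η₁ => G (η₁, η₂)) ξ.1) ξ.2

lemma IsPosBump.measurable_sqrtOp_fst {A : ℝ → ℂ} (hA : IsPosBump A) {G : ℝ × ℝ → ℂ}
    (hG : Measurable G) : Measurable fun p : ℝ × ℝ => sqrtOp A (fun η₁ => G (η₁, p.2)) p.1 := by
  have : StronglyMeasurable (Function.uncurry fun (p : ℝ × ℝ) (η : ℝ) =>
      sqrtKernel A p.1 η * G (η, p.2)) :=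
    (hA.measurable_uncurry_sqrtKernel.comp_measurable
      (show Measurable fun q : (ℝ × ℝ) × ℝ => (q.1.1, q.2) by fun_prop)).mul
      (hG.comp (show Measurable fun q : (ℝ × ℝ) × ℝ => (q.2, q.1.2) by
        fun_prop)).stronglyMeasurable
  exact this.integral_prod_right.measurable

lemma IsPosBump.wNormSq₂_sqrtOp₂_le {A : ℝ → ℂ} (hA : IsPosBump A) {s₁ s₂ : ℝ} (hs₁ : 0 ≤ s₁)
    (hs₂ : 0 ≤ s₂) : ∃ C : ℝ≥0∞, C ≠ ⊤ ∧ ∀ G : ℝ × ℝ → ℂ, Measurable G →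
      wNormSq₂ s₁ s₂ (sqrtOp₂ A G) ≤ C * wNormSq₂ s₁ s₂ G := by
  obtain ⟨C₁, hC₁, hb₁⟩ := hA.wNormSq_sqrtOp_le hs₁
  obtain ⟨C₂, hC₂, hb₂⟩ := hA.wNormSq_sqrtOp_le hs₂
  refine ⟨C₂ * C₁, by finiteness, fun G hG => ?_⟩
  set H : ℝ × ℝ → ℂ := fun p => sqrtOp A (fun η₁ => G (η₁, p.2)) p.1 with hH
  have hHm : Measurable H := hA.measurable_sqrtOp_fst hG
  calc wNormSq₂ s₁ s₂ (sqrtOp₂ A G) ≤ C₂ * wNormSq₂ s₁ s₂ H := by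
        unfold wNormSq₂
        rw [← lintegral_const_mul' _ _ hC₂]
        refine lintegral_mono fun ξ₁ => ?_
        have h : wNormSq s₂ (fun ξ₂ => sqrtOp₂ A G (ξ₁, ξ₂)) ≤
            C₂ * wNormSq s₂ fun η₂ => H (ξ₁, η₂) :=
          hb₂ (fun η₂ => H (ξ₁, η₂)) (hHm.comp measurable_prodMk_left)
        exact (mul_le_mul' le_rfl h).trans_eq (mul_left_comm _ _ _)
    _ ≤ C₂ * (C₁ * wNormSq₂ s₁ s₂ G) := by
        rw [wNormSq₂_eq_swap _ _ hHm, wNormSq₂_eq_swap _ _ hG, ← lintegral_const_mul' _ _ hC₁]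
        refine mul_le_mul' le_rfl (lintegral_mono fun ξ₂ => ?_)
        have h : wNormSq s₁ (fun ξ₁ => H (ξ₁, ξ₂)) ≤ C₁ * wNormSq s₁ fun η₁ => G (η₁, ξ₂) :=
          hb₁ (fun η₁ => G (η₁, ξ₂)) (hG.comp measurable_prodMk_right)
        exact (mul_le_mul' le_rfl h).trans_eq (mul_left_comm _ _ _)
    _ = C₂ * C₁ * wNormSq₂ s₁ s₂ G := (mul_assoc _ _ _).symm

lemma continuous_fourier2 {f : ℝ × ℝ → ℂ} (hf : Integrable f) : Continuous (fourier2 f) := by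
  refine continuous_of_dominated (bound := fun x => ‖f x‖) (fun ξ => ?_) (fun ξ => ?_) hf.norm ?_
  · exact (Continuous.aestronglyMeasurable (by fun_prop)).mul hf.1
  · refine Eventually.of_forall fun x => ?_
    rw [norm_mul, Complex.norm_exp_ofReal_mul_I, one_mul]
  · exact Eventually.of_forall fun x => by fun_prop

lemma prodSobolevNorm_sq (s₁ s₂ : ℝ) {f : ℝ × ℝ → ℂ} (hf : Measurable (fourier2 f)) :
    prodSobolevNorm s₁ s₂ f ^ 2 = wNormSq₂ s₁ s₂ (fourier2 f) := by
  have hw : ∀ s x : ℝ, ((1 + x ^ 2) ^ (s / 2)) ^ 2 = (1 + x ^ 2) ^ s := fun s x => by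
    rw [← Real.rpow_natCast, ← Real.rpow_mul (weight_pos x).le]
    norm_num
  rw [prodSobolevNorm, eLpNorm_two_sq]
  have h : ∀ ξ : ℝ × ℝ, ‖(((1 + |ξ.1| ^ 2) ^ (s₁ / 2) * (1 + |ξ.2| ^ 2) ^ (s₂ / 2) : ℝ) : ℂ) *
      fourier2 f ξ‖ₑ ^ 2 = ENNReal.ofReal ((1 + ξ.1 ^ 2) ^ s₁) *
        (ENNReal.ofReal ((1 + ξ.2 ^ 2) ^ s₂) * ‖fourier2 f ξ‖ₑ ^ 2) := by
    intro ξ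
    rw [sq_abs, sq_abs, enorm_mul, mul_pow, ← ofReal_norm (_ : ℂ), Complex.norm_real,
      Real.norm_of_nonneg (by positivity), ← ENNReal.ofReal_pow (by positivity), mul_pow, hw, hw,
      ENNReal.ofReal_mul (by positivity), mul_assoc]
  simp_rw [h]
  have h₁ : Measurable fun p : ℝ × ℝ => ENNReal.ofReal ((1 + p.1 ^ 2) ^ s₁) := by fun_prop
  have h₂ : Measurable fun p : ℝ × ℝ => ENNReal.ofReal ((1 + p.2 ^ 2) ^ s₂) := by fun_prop
  rw [Measure.volume_eq_prod, lintegral_prod _ (by fun_prop)]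
  simp_rw [lintegral_const_mul' _ _ ENNReal.ofReal_ne_top]
  rfl

lemma fourier2_eq_zero {f : ℝ × ℝ → ℂ} (hf : ¬ Integrable f) (ξ : ℝ × ℝ) : fourier2 f ξ = 0 := by
  refine integral_undef fun h => hf ?_
  have h2 := h.bdd_mul (f := fun x : ℝ × ℝ => Complex.exp
      (((2 * Real.pi * (x.1 * ξ.1 + x.2 * ξ.2) : ℝ) : ℂ) * Complex.I)) (c := 1)
    (Continuous.aestronglyMeasurable (by fun_prop))
    (Eventually.of_forall fun x => (Complex.norm_exp_ofReal_mul_I _).le)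
  refine h2.congr (Eventually.of_forall fun x => ?_)
  simp only
  rw [← mul_assoc, ← Complex.exp_add]
  push_cast
  ring_nf
  simp

/-- A reflection of the plane preserves the Sobolev norm, so symmetrization at most doubles it. -/
lemma prodSobolevNorm_symm_le (s₁ s₂ : ℝ) (R : ℝ × ℝ ≃ᵐ ℝ × ℝ)
    (hR : MeasurePreserving R volume volume)
    (hinner : ∀ x ξ, (R x).1 * (R ξ).1 + (R x).2 * (R ξ).2 = x.1 * ξ.1 + x.2 * ξ.2)
    (h₁ : ∀ ξ, |(R ξ).1| = |ξ.1|) (h₂ : ∀ ξ, |(R ξ).2| = |ξ.2|) {f : ℝ × ℝ → ℂ}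
    (hf : Integrable f) :
    prodSobolevNorm s₁ s₂ (fun x => f x + f (R x)) ≤ 2 * prodSobolevNorm s₁ s₂ f := by
  have hfR : Integrable (fun x => f (R x)) := hR.integrable_comp_of_integrable hf
  have hF : ∀ ξ, fourier2 (fun x => f (R x)) ξ = fourier2 f (R ξ) := by
    intro ξ
    have h := hR.integral_comp R.measurableEmbedding fun y => Complex.exp
      (((-2 * Real.pi * (y.1 * (R ξ).1 + y.2 * (R ξ).2) : ℝ) : ℂ) * Complex.I) * f y
    simp only [hinner] at h
    exact h
  have hψ : ∀ {g : ℝ × ℝ → ℂ}, Integrable g → ∀ ξ : ℝ × ℝ, Integrable fun x : ℝ × ℝ =>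
      Complex.exp (((-2 * Real.pi * (x.1 * ξ.1 + x.2 * ξ.2) : ℝ) : ℂ) * Complex.I) * g x :=
    fun hg ξ => hg.bdd_mul (c := 1) (Continuous.aestronglyMeasurable (by fun_prop))
      (Eventually.of_forall fun x => (Complex.norm_exp_ofReal_mul_I _).le)
  have hadd : ∀ ξ, fourier2 (fun x => f x + f (R x)) ξ = fourier2 f ξ + fourier2 f (R ξ) := by
    intro ξ
    rw [← hF]
    unfold fourier2
    rw [← integral_add (hψ hf ξ) (hψ hfR ξ)]
    simp_rw [mul_add]
  set g : ℝ × ℝ → ℂ := fun ξ =>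
    (((1 + |ξ.1| ^ 2) ^ (s₁ / 2) * (1 + |ξ.2| ^ 2) ^ (s₂ / 2) : ℝ) : ℂ) *
    fourier2 f ξ with hg
  have hgm : Measurable g := by
    have := (continuous_fourier2 hf).measurable
    fun_prop
  have hsum : (fun ξ : ℝ × ℝ =>
      (((1 + |ξ.1| ^ 2) ^ (s₁ / 2) * (1 + |ξ.2| ^ 2) ^ (s₂ / 2) : ℝ) : ℂ) *
      fourier2 (fun x => f x + f (R x)) ξ) = g + g ∘ R := by
    ext ξ
    simp only [hadd, hg, Pi.add_apply, Function.comp_apply, h₁, h₂, mul_add]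
  calc prodSobolevNorm s₁ s₂ (fun x => f x + f (R x)) = eLpNorm (g + g ∘ R) 2 volume := by
        rw [prodSobolevNorm, hsum]
    _ ≤ eLpNorm g 2 volume + eLpNorm (g ∘ R) 2 volume :=
        eLpNorm_add_le hgm.aestronglyMeasurable (hgm.comp R.measurable).aestronglyMeasurable
          (by norm_num)
    _ = 2 * prodSobolevNorm s₁ s₂ f := by
        rw [eLpNorm_comp_measurePreserving hgm.aestronglyMeasurable hR, two_mul]
        rfl

/-- Fubini together with Fourier inversion for the kernel. -/
lemma IsPosBump.sqrtOp_fourier {A : ℝ → ℂ} (hA : IsPosBump A) {F : ℝ × ℝ → ℂ} (hF : Integrable F)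
    {u : ℝ × ℝ → ℝ} (hu : Continuous u) (ξ : ℝ) :
    sqrtOp A (fun η =>
        ∫ x, Complex.exp (((-2 * Real.pi * (η * u x) : ℝ) : ℂ) * Complex.I) * F x) ξ =
      ∫ x, sqrtMod A ξ (u x) * F x := by
  unfold sqrtOp
  simp_rw [← integral_const_mul]
  rw [integral_integral_swap]
  · congr 1
    ext x
    rw [← hA.integral_sqrtKernel, ← integral_mul_const]
    congr 1
    ext η
    ring
  · have h1 : Integrable fun p : ℝ × (ℝ × ℝ) => sqrtKernel A ξ p.1 * F p.2 :=
      (memLp_one_iff_integrable.1 (hA.memLp_sqrtKernel ξ 1)).mul_prod hF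
    have h2 := h1.bdd_mul (f := fun p : ℝ × (ℝ × ℝ) => Complex.exp
        (((-2 * Real.pi * (p.1 * u p.2) : ℝ) : ℂ) * Complex.I)) (c := 1)
      (Continuous.aestronglyMeasurable (by fun_prop))
      (Eventually.of_forall fun x => (Complex.norm_exp_ofReal_mul_I _).le)
    refine h2.congr (Eventually.of_forall fun p => ?_)
    simp only [Function.uncurry]
    ring

lemma IsPosBump.sqrtOp₂_fourier2 {A : ℝ → ℂ} (hA : IsPosBump A) {m : ℝ × ℝ → ℂ}
    (hm : Integrable m) (ξ : ℝ × ℝ) :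
    sqrtOp₂ A (fourier2 m) ξ = ∫ x : ℝ × ℝ, sqrtMod A ξ.2 x.2 * (sqrtMod A ξ.1 x.1 * m x) := by
  have hcont := (hA.modulate ξ.1).contDiff.continuous
  obtain ⟨M, hM⟩ := (hA.modulate ξ.1).hasCompactSupport.exists_bound_of_continuous hcont
  have hm1 : Integrable fun x : ℝ × ℝ => sqrtMod A ξ.1 x.1 * m x :=
    hm.bdd_mul (c := M) (Continuous.aestronglyMeasurable (by fun_prop))
      (Eventually.of_forall fun x => hM _)
  have hm2 : ∀ η₂ : ℝ, Integrable fun x : ℝ × ℝ =>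
      Complex.exp (((-2 * Real.pi * (η₂ * x.2) : ℝ) : ℂ) * Complex.I) * m x :=
    fun η₂ => hm.bdd_mul (c := 1) (Continuous.aestronglyMeasurable (by fun_prop))
      (Eventually.of_forall fun x => (Complex.norm_exp_ofReal_mul_I _).le)
  rw [← hA.sqrtOp_fourier hm1 continuous_snd]
  unfold sqrtOp₂
  congr 1
  ext η₂
  have h := hA.sqrtOp_fourier (hm2 η₂) continuous_fst ξ.1
  calc _ = ∫ x : ℝ × ℝ, sqrtMod A ξ.1 x.1 *
        (Complex.exp (((-2 * Real.pi * (η₂ * x.2) : ℝ) : ℂ) * Complex.I) * m x) := by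
        rw [← h]
        congr 1
        ext η₁
        unfold fourier2
        congr 1
        ext x
        rw [← mul_assoc, ← Complex.exp_add]
        push_cast
        ring_nf
    _ = _ := by
        congr 1
        ext x
        ring

/-- The open first quadrant. -/
def quadrant : Set (ℝ × ℝ) := Ioi 0 ×ˢ Ioi 0

lemma measurableSet_quadrant : MeasurableSet quadrant := measurableSet_Ioi.prod measurableSet_Ioi

/-- The map `(x, y) ↦ (x², y²)`. -/
def sqMap : ℝ × ℝ → ℝ × ℝ := Prod.map (fun t => t ^ 2) (fun t => t ^ 2)

lemma sqMap_apply (p : ℝ × ℝ) : sqMap p = (p.1 ^ 2, p.2 ^ 2) := rfl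

lemma image_sqMap_quadrant : sqMap '' quadrant = quadrant := by
  rw [sqMap, quadrant, Set.prodMap_image_prod, image_sq_Ioi]

lemma injOn_sqMap_quadrant : InjOn sqMap quadrant := injOn_sq_Ioi.prodMap injOn_sq_Ioi

/-- The derivative of `sqMap`. -/
noncomputable def sqMapDeriv (p : ℝ × ℝ) : ℝ × ℝ →L[ℝ] ℝ × ℝ :=
  (ContinuousLinearMap.toSpanSingleton ℝ (2 * p.1)).prodMap
    (ContinuousLinearMap.toSpanSingleton ℝ (2 * p.2))

lemma hasFDerivWithinAt_sqMap (s : Set (ℝ × ℝ)) (p : ℝ × ℝ) :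
    HasFDerivWithinAt sqMap (sqMapDeriv p) s p := by
  have h : ∀ x : ℝ, HasFDerivAt (fun t : ℝ => t ^ 2)
      (ContinuousLinearMap.toSpanSingleton ℝ (2 * x)) x := fun x => by
    simpa using (hasDerivAt_pow 2 x).hasFDerivAt
  exact ((h p.1).prodMap p (h p.2)).hasFDerivWithinAt

lemma det_sqMapDeriv (p : ℝ × ℝ) : (sqMapDeriv p).det = 4 * p.1 * p.2 := by
  rw [ContinuousLinearMap.det, sqMapDeriv, ContinuousLinearMap.coe_prodMap, LinearMap.det_prodMap,
    LinearMap.det_ring, LinearMap.det_ring]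
  simp
  ring

lemma abs_det_sqMapDeriv_smul {p : ℝ × ℝ} (hp : p ∈ quadrant) (z : ℂ) :
    |(sqMapDeriv p).det| • z = ((4 * p.1 * p.2 : ℝ) : ℂ) * z := by
  have h₁ : 0 < p.1 := hp.1
  have h₂ : 0 < p.2 := hp.2
  rw [det_sqMapDeriv, abs_of_pos (by positivity), Complex.real_smul]

lemma integrableOn_quadrant_comp_sqMap (F : ℝ × ℝ → ℂ) : IntegrableOn F quadrant ↔
    IntegrableOn (fun p => ((4 * p.1 * p.2 : ℝ) : ℂ) * F (sqMap p)) quadrant := by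
  have h := integrableOn_image_iff_integrableOn_abs_det_fderiv_smul volume measurableSet_quadrant
    (fun p _ => hasFDerivWithinAt_sqMap quadrant p) injOn_sqMap_quadrant F
  rw [image_sqMap_quadrant] at h
  rw [h]
  exact integrableOn_congr_fun (fun p hp => abs_det_sqMapDeriv_smul hp _) measurableSet_quadrant

lemma setIntegral_quadrant_comp_sqMap (F : ℝ × ℝ → ℂ) : ∫ x in quadrant, F x =
    ∫ p in quadrant, ((4 * p.1 * p.2 : ℝ) : ℂ) * F (sqMap p) := by
  have h := integral_image_eq_integral_abs_det_fderiv_smul volume measurableSet_quadrant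
    (fun p _ => hasFDerivWithinAt_sqMap quadrant p) injOn_sqMap_quadrant F
  rw [image_sqMap_quadrant] at h
  rw [h]
  exact setIntegral_congr_fun measurableSet_quadrant fun p hp => abs_det_sqMapDeriv_smul hp _

lemma exists_isPosBump : ∃ A : ℝ → ℂ, IsPosBump A ∧
    ∀ t : ℝ, 0 < t → t ^ 2 ∈ Icc ((1 : ℝ) / 4) 4 → ((2 * t : ℝ) : ℂ) * A (t ^ 2) = 1 := by
  let χ : ContDiffBump (17 / 8 : ℝ) := ⟨15 / 8, 2, by norm_num, by norm_num⟩
  have hχ : IsPosBump (fun x => ((χ x : ℝ) : ℂ)) := by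
    refine isPosBump_of_eq_zero (a := 1 / 8) (b := 33 / 8) (u := fun x => ((χ x : ℝ) : ℂ))
      (by norm_num) (fun x hx => ?_) (fun _ _ => rfl)
      fun x _ => (Complex.ofRealCLM.contDiff.comp χ.contDiff).contDiffAt
    rw [χ.zero_of_le_dist, Complex.ofReal_zero]
    rw [Real.dist_eq]
    change 2 ≤ _
    by_contra! h
    rw [abs_lt] at h
    exact hx ⟨by linarith, by linarith⟩
  refine ⟨_, hχ.mul (u := fun x => (2 * ((√x : ℝ) : ℂ))⁻¹) fun x hx => ?_, fun t ht h => ?_⟩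
  · refine (contDiffAt_const.mul (contDiffAt_ofReal_sqrt hx)).inv ?_
    have := (Real.sqrt_pos.2 hx).ne'
    simpa using this
  · have hone : χ (t ^ 2) = 1 := by
      refine χ.one_of_mem_closedBall ?_
      rw [Metric.mem_closedBall, Real.dist_eq]
      change _ ≤ 15 / 8
      rw [abs_le]
      constructor <;> linarith [h.1, h.2]
    have ht' : (t : ℂ) ≠ 0 := by exact_mod_cast ht.ne'
    simp only [hone, Real.sqrt_sq ht.le]
    push_cast
    field_simp

/-- On the frequency side, the square substitution restricted to the first quadrant is
`sqrtOp₂ A`. -/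
lemma IsPosBump.fourier2_quadrant {A : ℝ → ℂ} (hA : IsPosBump A)
    (hA1 : ∀ t : ℝ, 0 < t → t ^ 2 ∈ Icc ((1 : ℝ) / 4) 4 → ((2 * t : ℝ) : ℂ) * A (t ^ 2) = 1)
    {m : ℝ × ℝ → ℂ} (hm : Integrable m)
    (hsupp : Function.support m ⊆ Icc ((1 : ℝ) / 4) 4 ×ˢ Icc ((1 : ℝ) / 4) 4) (ξ : ℝ × ℝ) :
    fourier2 (quadrant.indicator fun p => m (sqMap p)) ξ = sqrtOp₂ A (fourier2 m) ξ := by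
  have hq : Function.support m ⊆ quadrant :=
    hsupp.trans (prod_mono (fun x hx => lt_of_lt_of_le (by norm_num) hx.1)
      fun x hx => lt_of_lt_of_le (by norm_num) hx.1)
  rw [hA.sqrtOp₂_fourier2 hm, ← setIntegral_eq_integral_of_forall_compl_eq_zero (s := quadrant),
    setIntegral_quadrant_comp_sqMap, ← integral_indicator measurableSet_quadrant]
  · unfold fourier2
    congr 1
    ext p
    by_cases hp : p ∈ quadrant
    · rw [indicator_of_mem hp, indicator_of_mem hp]
      by_cases hmp : m (sqMap p) = 0
      · simp [hmp]
      have hs := hsupp hmp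
      have e₁ := hA1 p.1 hp.1 hs.1
      have e₂ := hA1 p.2 hp.2 hs.2
      simp only [sqMap_apply, sqrtMod, Real.sqrt_sq (le_of_lt hp.1), Real.sqrt_sq (le_of_lt hp.2)]
      have he : Complex.exp (((-2 * Real.pi * (p.1 * ξ.1 + p.2 * ξ.2) : ℝ) : ℂ) * Complex.I) =
          Complex.exp (((-2 * Real.pi * (p.1 * ξ.1) : ℝ) : ℂ) * Complex.I) *
          Complex.exp (((-2 * Real.pi * (p.2 * ξ.2) : ℝ) : ℂ) * Complex.I) := by
        rw [← Complex.exp_add]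
        push_cast
        ring_nf
      rw [he]
      have hcoef : ((4 * p.1 * p.2 : ℝ) : ℂ) * (A (p.1 ^ 2) * A (p.2 ^ 2)) = 1 := by
        rw [← mul_one (1 : ℂ)]
        nth_rewrite 1 [← e₁]
        rw [← e₂]
        push_cast
        ring
      linear_combination (-Complex.exp (((-2 * Real.pi * (p.1 * ξ.1) : ℝ) : ℂ) * Complex.I) *
          Complex.exp (((-2 * Real.pi * (p.2 * ξ.2) : ℝ) : ℂ) * Complex.I) *
          m (p.1 ^ 2, p.2 ^ 2)) * hcoef
    · rw [indicator_of_notMem hp, indicator_of_notMem hp, mul_zero]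
  · intro x hx
    have : m x = 0 := by_contra fun h => hx (hq h)
    rw [this, mul_zero, mul_zero]

lemma integrable_of_integrable_comp_sqMap {m : ℝ × ℝ → ℂ}
    (hsupp : Function.support m ⊆ Icc ((1 : ℝ) / 4) 4 ×ˢ Icc ((1 : ℝ) / 4) 4)
    (h : Integrable fun p => m (sqMap p)) : Integrable m := by
  have hq : Function.support m ⊆ quadrant :=
    hsupp.trans (prod_mono (fun x hx => lt_of_lt_of_le (by norm_num) hx.1)
      fun x hx => lt_of_lt_of_le (by norm_num) hx.1)
  rw [← integrableOn_iff_integrable_of_support_subset hq, integrableOn_quadrant_comp_sqMap]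
  refine Integrable.integrableOn ?_
  refine (h.const_mul 16).mono ((Continuous.aestronglyMeasurable (by fun_prop)).mul h.1)
    (Eventually.of_forall fun p => ?_)
  by_cases hmp : m (sqMap p) = 0
  · simp [hmp]
  have hs := hsupp hmp
  have h₁ : |p.1| ≤ 2 := abs_le_of_sq_le_sq (by linarith [show p.1 ^ 2 ≤ 4 from hs.1.2]) two_pos.le
  have h₂ : |p.2| ≤ 2 := abs_le_of_sq_le_sq (by linarith [show p.2 ^ 2 ≤ 4 from hs.2.2]) two_pos.le
  rw [norm_mul, norm_mul, Complex.norm_real, Real.norm_eq_abs, abs_mul, abs_mul]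
  have : |p.1| * |p.2| ≤ 2 * 2 := by gcongr
  gcongr
  norm_num
  linarith

/-- Reflection in the first variable. -/
def reflFst : ℝ × ℝ ≃ᵐ ℝ × ℝ := (MeasurableEquiv.neg ℝ).prodCongr (MeasurableEquiv.refl ℝ)

/-- Reflection in the second variable. -/
def reflSnd : ℝ × ℝ ≃ᵐ ℝ × ℝ := (MeasurableEquiv.refl ℝ).prodCongr (MeasurableEquiv.neg ℝ)

lemma reflFst_apply (x : ℝ × ℝ) : reflFst x = (-x.1, x.2) := rfl

lemma reflSnd_apply (x : ℝ × ℝ) : reflSnd x = (x.1, -x.2) := rfl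

lemma measurePreserving_reflFst : MeasurePreserving reflFst volume volume :=
  (Measure.measurePreserving_neg volume).prod (MeasurePreserving.id volume)

lemma measurePreserving_reflSnd : MeasurePreserving reflSnd volume volume :=
  (MeasurePreserving.id volume).prod (Measure.measurePreserving_neg volume)

lemma prodSobolevNorm_comp_sqMap_le_quadrant (s₁ s₂ : ℝ) {m : ℝ × ℝ → ℂ}
    (hsupp : Function.support m ⊆ Icc ((1 : ℝ) / 4) 4 ×ˢ Icc ((1 : ℝ) / 4) 4)
    (h : Integrable fun p => m (sqMap p)) :
    prodSobolevNorm s₁ s₂ (fun p => m (sqMap p)) ≤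
      4 * prodSobolevNorm s₁ s₂ (quadrant.indicator fun p => m (sqMap p)) := by
  set φ := quadrant.indicator fun p => m (sqMap p) with hφ
  have hφi : Integrable φ := h.indicator measurableSet_quadrant
  have hφ₂i : Integrable fun x => φ x + φ (reflSnd x) :=
    hφi.add (measurePreserving_reflSnd.integrable_comp_of_integrable hφi)
  have hne : ∀ p, m (sqMap p) ≠ 0 → p.1 ≠ 0 ∧ p.2 ≠ 0 := by
    intro p hp
    have hs := hsupp hp
    constructor <;> intro h0
    · have := hs.1.1
      norm_num [sqMap_apply, h0] at this
    · have := hs.2.1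
      norm_num [sqMap_apply, h0] at this
  have hsum : (fun p => m (sqMap p)) = fun x => (φ x + φ (reflSnd x)) +
      (φ (reflFst x) + φ (reflSnd (reflFst x))) := by
    ext p
    simp only [hφ, indicator_apply, quadrant, mem_prod, mem_Ioi, reflFst_apply, reflSnd_apply,
      sqMap_apply, neg_sq, Left.neg_pos_iff]
    by_cases hp : m (sqMap p) = 0
    · rw [sqMap_apply] at hp
      simp [hp]
    · obtain ⟨h₁, h₂⟩ := hne p hp
      rcases lt_or_gt_of_ne h₁ with h₁ | h₁ <;> rcases lt_or_gt_of_ne h₂ with h₂ | h₂ <;>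
        simp [h₁, h₂, h₁.not_gt, h₂.not_gt]
  calc prodSobolevNorm s₁ s₂ (fun p => m (sqMap p))
      ≤ 2 * prodSobolevNorm s₁ s₂ (fun x => φ x + φ (reflSnd x)) := by
        rw [hsum]
        exact prodSobolevNorm_symm_le s₁ s₂ reflFst measurePreserving_reflFst
          (fun x ξ => by simp [reflFst_apply]) (fun ξ => by simp [reflFst_apply])
          (fun ξ => by simp [reflFst_apply]) hφ₂i
    _ ≤ 2 * (2 * prodSobolevNorm s₁ s₂ φ) := by
        gcongr
        exact prodSobolevNorm_symm_le s₁ s₂ reflSnd measurePreserving_reflSnd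
          (fun x ξ => by simp [reflSnd_apply]) (fun ξ => by simp [reflSnd_apply])
          (fun ξ => by simp [reflSnd_apply]) hφi
    _ = 4 * prodSobolevNorm s₁ s₂ φ := by
        rw [← mul_assoc]
        norm_num

/-- The square substitution `ψ(λ₁,λ₂) := m(λ₁²,λ₂²)` is bounded on the product
Sobolev space: `‖ψ‖_{W^{(σ₁,σ₂),2}} ≤ C ‖m‖_{W^{(σ₁,σ₂),2}}` for all `m`
supported in `[1/4,4] × [1/4,4]` with finite norm. -/
theorem statement10 (σ₁ σ₂ : ℝ) (hσ₁ : 0 ≤ σ₁) (hσ₂ : 0 ≤ σ₂) :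
    ∃ C : ℝ, 0 < C ∧
      ∀ m : ℝ × ℝ → ℂ,
        Function.support m ⊆ Set.Icc ((1:ℝ)/4) 4 ×ˢ Set.Icc ((1:ℝ)/4) 4 →
        prodSobolevNorm σ₁ σ₂ m < ⊤ →
        prodSobolevNorm σ₁ σ₂ (fun p : ℝ × ℝ => m (p.1 ^ 2, p.2 ^ 2)) ≤
          ENNReal.ofReal C * prodSobolevNorm σ₁ σ₂ m := by

  obtain ⟨A, hA, hA1⟩ := exists_isPosBump
  obtain ⟨C, hC, hb⟩ := hA.wNormSq₂_sqrtOp₂_le hσ₁ hσ₂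
  refine ⟨4 * (1 + C.toReal), by positivity, fun m hsupp _ => ?_⟩
  change prodSobolevNorm σ₁ σ₂ (fun p => m (sqMap p)) ≤ _
  by_cases hψ : Integrable fun p => m (sqMap p)
  swap
  · have h0 : prodSobolevNorm σ₁ σ₂ (fun p => m (sqMap p)) = 0 := by
      simp [prodSobolevNorm, fourier2_eq_zero hψ]
    rw [h0]
    exact zero_le
  have hm := integrable_of_integrable_comp_sqMap hsupp hψ
  have hmm := (continuous_fourier2 hm).measurable
  have hφ := (continuous_fourier2 (hψ.indicator measurableSet_quadrant)).measurable
  have hsq : prodSobolevNorm σ₁ σ₂ (quadrant.indicator fun p => m (sqMap p)) ≤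
      (1 + C) * prodSobolevNorm σ₁ σ₂ m := by
    rw [← ENNReal.pow_le_pow_left_iff two_ne_zero, mul_pow, prodSobolevNorm_sq _ _ hφ,
      prodSobolevNorm_sq _ _ hmm, funext (hA.fourier2_quadrant hA1 hm hsupp)]
    refine (hb _ hmm).trans (mul_le_mul' ?_ le_rfl)
    calc C ≤ 1 + C := le_add_left le_rfl
      _ ≤ (1 + C) ^ 2 := le_self_pow₀ (le_add_right le_rfl) two_ne_zero
  calc prodSobolevNorm σ₁ σ₂ (fun p => m (sqMap p))
      ≤ 4 * prodSobolevNorm σ₁ σ₂ (quadrant.indicator fun p => m (sqMap p)) :=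
        prodSobolevNorm_comp_sqMap_le_quadrant σ₁ σ₂ hsupp hψ
    _ ≤ 4 * ((1 + C) * prodSobolevNorm σ₁ σ₂ m) := mul_le_mul' le_rfl hsq
    _ = ENNReal.ofReal (4 * (1 + C.toReal)) * prodSobolevNorm σ₁ σ₂ m := by
        rw [ENNReal.ofReal_mul (by norm_num), ENNReal.ofReal_add zero_le_one ENNReal.toReal_nonneg,
          ENNReal.ofReal_toReal hC, ENNReal.ofReal_one, mul_assoc]
        norm_num
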